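/- arXiv:0807.0856 — 2 statements merged into one kernel-verified Lean document; each statement's English description precedes it below -/
import Mathlib

section
/- Let μ be a Borel measure in ℝ² with compact support, supp μ ⊂ Π, and μ(Π) ∈ ℕ, where Π is a rectangle whose ratio of side lengths is l₀ ≥ 1. Suppose in addition that for any line L parallel to a side of Π there is at most one point p ∈ L with 0 < μ({p}) < 1, while always μ(L ∖ {p}) = 0. Then there exist a system of rectangles Π_k ⊂ Π with sides parallel to the sides of Π, and measures μ_k, with the following properties: (1) supp μ_k ⊂ Π_k; (2) μ_k(Π_k) = 1 and Σ_k μ_k = μ; (3) the interiors of the convex hulls of the supports of the μ_k are pairwise disjoint; (4) the ratio of the side lengths of each Π_k lies in the interval [1/l, l], where l = max{l₀, 3}; (5) each point of the plane belongs to the interiors of at most 4 of the rectangles Π_k. -/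
open MeasureTheory Metric

/-- A closed axis-parallel rectangle in `ℂ ≅ ℝ²`. -/
def rect (a b c e : ℝ) : Set ℂ := {z : ℂ | z.re ∈ Set.Icc a b ∧ z.im ∈ Set.Icc c e}

/-- The support of a measure on `ℂ`: points all of whose neighborhoods have positive mass. -/
def msupport (μ : Measure ℂ) : Set ℂ := {z : ℂ | ∀ t > (0:ℝ), μ (ball z t) ≠ 0}

/-- The measure `ν`, carried by the rectangle `f ∈ [A, B]`, `g ∈ [C, E]`, is a finite sum of unit
measures on subrectangles of side ratio at most `l`, with non-overlapping hulls of supports, such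
that `(x, y)` is in the interior of at most `N x y` of the subrectangles. -/
def HasPartition (l : ℝ) (f g : ℂ →L[ℝ] ℝ) (A B C E : ℝ) (ν : Measure ℂ) (N : ℝ → ℝ → ℕ) : Prop :=
  ∃ (ι : Type) (_ : Fintype ι) (A' B' C' E' : ι → ℝ) (μk : ι → Measure ℂ),
    (∀ k, A ≤ A' k ∧ A' k < B' k ∧ B' k ≤ B) ∧
    (∀ k, C ≤ C' k ∧ C' k < E' k ∧ E' k ≤ E) ∧
    (∀ k, ∀ᵐ z ∂μk k, f z ∈ Set.Icc (A' k) (B' k)) ∧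
    (∀ k, ∀ᵐ z ∂μk k, g z ∈ Set.Icc (C' k) (E' k)) ∧
    (∀ k, μk k Set.univ = 1) ∧
    (∑ k, μk k) = ν ∧
    (∀ k k', k ≠ k' →
      interior (convexHull ℝ (msupport (μk k))) ∩
        interior (convexHull ℝ (msupport (μk k'))) = ∅) ∧
    (∀ k, B' k - A' k ≤ l * (E' k - C' k)) ∧
    (∀ k, E' k - C' k ≤ l * (B' k - A' k)) ∧
    (∀ x y, ∑ k, (if x ∈ Set.Ioo (A' k) (B' k) ∧ y ∈ Set.Ioo (C' k) (E' k) then 1 else 0) ≤ N x y)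

/-- The value `x` lies in the convex hull of the projection of `ν` by `f`. -/
def InSpread (ν : Measure ℂ) (f : ℂ →L[ℝ] ℝ) (x : ℝ) : Prop :=
  ν {z | f z ≤ x} ≠ 0 ∧ ν {z | x ≤ f z} ≠ 0

open Classical in
/-- The bound on the multiplicity of the covering constructed below. -/
noncomputable def spreadBound (ν : Measure ℂ) (f g : ℂ →L[ℝ] ℝ) (x y : ℝ) : ℕ :=
  1 + (if InSpread ν f x then 1 else 0) + (if InSpread ν g y then 1 else 0)

lemma InSpread.mono {ν ν' : Measure ℂ} {f : ℂ →L[ℝ] ℝ} {x : ℝ} (h : ν ≤ ν')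
    (hx : InSpread ν f x) : InSpread ν' f x :=
  ⟨fun h0 => hx.1 (le_antisymm ((h _).trans h0.le) zero_le),
    fun h0 => hx.2 (le_antisymm ((h _).trans h0.le) zero_le)⟩

lemma spreadBound_mono {ν ν' : Measure ℂ} (h : ν ≤ ν') (f g : ℂ →L[ℝ] ℝ) (x y : ℝ) :
    spreadBound ν f g x y ≤ spreadBound ν' f g x y := by
  unfold spreadBound
  have h1 : InSpread ν f x → InSpread ν' f x := InSpread.mono h
  have h2 : InSpread ν g y → InSpread ν' g y := InSpread.mono h
  split_ifs <;> first | omega | tauto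

lemma spreadBound_swap (ν : Measure ℂ) (f g : ℂ →L[ℝ] ℝ) (x y : ℝ) :
    spreadBound ν f g x y = spreadBound ν g f y x := by
  unfold spreadBound; omega

lemma spreadBound_add_one_le {ν ν' : Measure ℂ} (h : ν ≤ ν') {f g : ℂ →L[ℝ] ℝ} {x : ℝ} (y : ℝ)
    (hx : ¬ InSpread ν f x) (hx' : InSpread ν' f x) :
    spreadBound ν f g x y + 1 ≤ spreadBound ν' f g x y := by
  unfold spreadBound
  have h2 : InSpread ν g y → InSpread ν' g y := InSpread.mono h
  split_ifs <;> first | omega | tauto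

lemma msupport_subset_of_ae {μ : Measure ℂ} {s : Set ℂ} (hs : IsClosed s)
    (h : ∀ᵐ z ∂μ, z ∈ s) : msupport μ ⊆ s := by
  intro z hz
  by_contra hzs
  obtain ⟨t, ht, hts⟩ := Metric.isOpen_iff.1 hs.isOpen_compl z hzs
  exact hz t ht (measure_mono_null hts h)

lemma interior_hull_inter_eq_empty {μ ν : Measure ℂ} {f : ℂ →L[ℝ] ℝ} (hf : Function.Surjective f)
    {x : ℝ} (hμ : ∀ᵐ z ∂μ, f z ≤ x) (hν : ∀ᵐ z ∂ν, x ≤ f z) :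
    interior (convexHull ℝ (msupport μ)) ∩ interior (convexHull ℝ (msupport ν)) = ∅ := by
  have h1 : convexHull ℝ (msupport μ) ⊆ {z | f z ≤ x} :=
    convexHull_min (msupport_subset_of_ae (isClosed_le f.continuous continuous_const) hμ)
      (convex_halfSpace_le f.toLinearMap.isLinear x)
  have h2 : convexHull ℝ (msupport ν) ⊆ {z | x ≤ f z} :=
    convexHull_min (msupport_subset_of_ae (isClosed_le continuous_const f.continuous) hν)
      (convex_halfSpace_ge f.toLinearMap.isLinear x)
  rw [← interior_inter, ← Set.subset_empty_iff]
  have h3 : convexHull ℝ (msupport μ) ∩ convexHull ℝ (msupport ν) ⊆ f ⁻¹' {x} :=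
    fun z hz => le_antisymm (h1 hz.1) (h2 hz.2)
  refine (interior_mono h3).trans ?_
  rw [← (f.isOpenMap hf).preimage_interior_eq_interior_preimage f.continuous]
  simp

namespace HasPartition

variable {l A B C E : ℝ} {f g : ℂ →L[ℝ] ℝ} {ν ν₁ ν₂ : Measure ℂ} {N N₁ N₂ : ℝ → ℝ → ℕ}

lemma zero : HasPartition l f g A B C E 0 (fun _ _ => 0) :=
  ⟨Empty, inferInstance, Empty.elim, Empty.elim, Empty.elim, Empty.elim, Empty.elim,
    by simp⟩

lemma unit (hAB : A < B) (hCE : C < E) (h₁ : B - A ≤ l * (E - C)) (h₂ : E - C ≤ l * (B - A))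
    (hf : ∀ᵐ z ∂ν, f z ∈ Set.Icc A B) (hg : ∀ᵐ z ∂ν, g z ∈ Set.Icc C E) (hν : ν Set.univ = 1) :
    HasPartition l f g A B C E ν (fun _ _ => 1) := by
  refine ⟨Unit, inferInstance, fun _ => A, fun _ => B, fun _ => C, fun _ => E, fun _ => ν,
    by simp [hAB], by simp [hCE], fun _ => hf, fun _ => hg, fun _ => hν, by simp,
    fun k k' h => (h rfl).elim, fun _ => h₁, fun _ => h₂, fun x y => ?_⟩
  simp only [Finset.univ_unique, Finset.sum_const, Finset.card_singleton, one_smul]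
  split_ifs <;> simp

lemma swap (h : HasPartition l f g A B C E ν N) :
    HasPartition l g f C E A B ν (fun x y => N y x) := by
  obtain ⟨ι, _, A', B', C', E', μk, h1, h2, h3, h4, h5, h6, h7, h8, h9, h10⟩ := h
  exact ⟨ι, _, C', E', A', B', μk, h2, h1, h4, h3, h5, h6, h7, h9, h8,
    fun x y => by simpa only [and_comm] using h10 y x⟩

lemma mono {A₁ B₁ : ℝ} (h : HasPartition l f g A₁ B₁ C E ν N₁) (hA : A ≤ A₁) (hB : B₁ ≤ B)
    (hN : ∀ x y, N₁ x y ≤ N x y) : HasPartition l f g A B C E ν N := by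
  obtain ⟨ι, _, A', B', C', E', μk, h1, h2, h3, h4, h5, h6, h7, h8, h9, h10⟩ := h
  exact ⟨ι, _, A', B', C', E', μk,
    fun k => ⟨hA.trans (h1 k).1, (h1 k).2.1, (h1 k).2.2.trans hB⟩, h2, h3, h4, h5, h6, h7, h8, h9,
    fun x y => (h10 x y).trans (hN x y)⟩

open Classical in
lemma localize (h : HasPartition l f g A B C E ν N) :
    HasPartition l f g A B C E ν (fun x y => if x ∈ Set.Ioo A B then N x y else 0) := by
  obtain ⟨ι, _, A', B', C', E', μk, h1, h2, h3, h4, h5, h6, h7, h8, h9, h10⟩ := h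
  refine ⟨ι, _, A', B', C', E', μk, h1, h2, h3, h4, h5, h6, h7, h8, h9, fun x y => ?_⟩
  dsimp only
  split_ifs with hx
  · exact h10 x y
  · refine (Finset.sum_eq_zero fun k _ => if_neg fun hk => hx ?_).le
    exact ⟨(h1 k).1.trans_lt hk.1.1, hk.1.2.trans_le (h1 k).2.2⟩

lemma add (hf : Function.Surjective f) {x : ℝ} (h₁ : HasPartition l f g A B C E ν₁ N₁)
    (h₂ : HasPartition l f g A B C E ν₂ N₂) (hx₁ : ∀ᵐ z ∂ν₁, f z ≤ x)
    (hx₂ : ∀ᵐ z ∂ν₂, x ≤ f z) :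
    HasPartition l f g A B C E (ν₁ + ν₂) (fun x y => N₁ x y + N₂ x y) := by
  obtain ⟨ι, _, A', B', C', E', μk, h1, h2, h3, h4, h5, h6, h7, h8, h9, h10⟩ := h₁
  obtain ⟨κ, _, A'', B'', C'', E'', μk', j1, j2, j3, j4, j5, j6, j7, j8, j9, j10⟩ := h₂
  have hle : ∀ k, μk k ≤ ν₁ := fun k => by
    rw [← h6, Measure.le_iff']
    intro s
    rw [Measure.finsetSum_apply]
    exact Finset.single_le_sum (f := fun k => μk k s) (fun i _ => zero_le) (Finset.mem_univ k)
  have jle : ∀ k, μk' k ≤ ν₂ := fun k => by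
    rw [← j6, Measure.le_iff']
    intro s
    rw [Measure.finsetSum_apply]
    exact Finset.single_le_sum (f := fun k => μk' k s) (fun i _ => zero_le) (Finset.mem_univ k)
  have hsep : ∀ k k', interior (convexHull ℝ (msupport (μk k))) ∩
      interior (convexHull ℝ (msupport (μk' k'))) = ∅ := fun k k' =>
    interior_hull_inter_eq_empty hf (ae_mono (hle k) hx₁) (ae_mono (jle k') hx₂)
  refine ⟨ι ⊕ κ, inferInstance, Sum.elim A' A'', Sum.elim B' B'', Sum.elim C' C'', Sum.elim E' E'',
    Sum.elim μk μk', ?_, ?_, ?_, ?_, ?_, ?_, ?_, ?_, ?_, ?_⟩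
  · rintro (k | k); exacts [h1 k, j1 k]
  · rintro (k | k); exacts [h2 k, j2 k]
  · rintro (k | k); exacts [h3 k, j3 k]
  · rintro (k | k); exacts [h4 k, j4 k]
  · rintro (k | k); exacts [h5 k, j5 k]
  · simp [h6, j6]
  · rintro (k | k) (k' | k') hk
    · exact h7 k k' fun h => hk (h ▸ rfl)
    · exact hsep k k'
    · rw [Set.inter_comm]; exact hsep k' k
    · exact j7 k k' fun h => hk (h ▸ rfl)
  · rintro (k | k); exacts [h8 k, j8 k]
  · rintro (k | k); exacts [h9 k, j9 k]
  · intro x y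
    rw [Fintype.sum_sum_type]
    exact add_le_add (h10 x y) (j10 x y)

end HasPartition

/-- A finite measure can be cut by a level set of `f`, dividing the mass of this level set between
both sides, so that the lower part has prescribed mass `m`. -/
lemma exists_split {f : ℂ →L[ℝ] ℝ} {ν : Measure ℂ} [IsFiniteMeasure ν] {A U : ℝ}
    (hA : ∀ᵐ z ∂ν, A ≤ f z) (hAU : A ≤ U) {m : ENNReal} (hm : m ≤ ν {z | f z ≤ U}) :
    ∃ (x : ℝ) (ν₁ ν₂ : Measure ℂ), A ≤ x ∧ x ≤ U ∧ ν₁ + ν₂ = ν ∧ ν₁ Set.univ = m ∧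
      (∀ᵐ z ∂ν₁, f z ≤ x) ∧ (∀ᵐ z ∂ν₂, x ≤ f z) := by
  have hfm : Measurable f := f.continuous.measurable
  set S : Set ℝ := {x | A ≤ x ∧ m ≤ ν {z | f z ≤ x}}
  have hUS : U ∈ S := ⟨hAU, hm⟩
  have hbdd : BddBelow S := ⟨A, fun x hx => hx.1⟩
  set x := sInf S
  have hAx : A ≤ x := le_csInf ⟨U, hUS⟩ fun y hy => hy.1
  have hup : m ≤ ν {z | f z ≤ x} := by
    have hI : {z | f z ≤ x} = ⋂ k : ℕ, {z | f z ≤ x + 1 / ((k : ℝ) + 1)} := by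
      ext z
      simp only [Set.mem_ofPred_eq, Set.mem_iInter]
      refine ⟨fun h k => h.trans (by simp; positivity), fun h => ?_⟩
      refine ge_of_tendsto' (x := Filter.atTop) (f := fun k : ℕ => x + 1 / ((k : ℝ) + 1)) ?_ h
      simpa using tendsto_one_div_add_atTop_nhds_zero_nat.const_add x
    rw [hI, Antitone.measure_iInter]
    · refine le_iInf fun k => ?_
      have hlt : x < x + 1 / ((k : ℝ) + 1) := by
        have : 0 < 1 / ((k : ℝ) + 1) := by positivity
        linarith
      obtain ⟨y, hy, hyx⟩ := exists_lt_of_csInf_lt ⟨U, hUS⟩ hlt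
      exact hy.2.trans (measure_mono fun z hz => le_trans hz hyx.le)
    · intro i j hij z hz
      refine le_trans (show f z ≤ _ from hz) ?_
      have := Nat.one_div_le_one_div (α := ℝ) hij
      linarith
    · exact fun k => (measurableSet_le hfm measurable_const).nullMeasurableSet
    · exact ⟨0, measure_ne_top _ _⟩
  have hlow : ν {z | f z < x} ≤ m := by
    have hU' : {z | f z < x} = ⋃ k : ℕ, {z | f z ≤ x - 1 / ((k : ℝ) + 1)} := by
      ext z
      simp only [Set.mem_ofPred_eq, Set.mem_iUnion]
      constructor
      · intro h
        obtain ⟨k, hk⟩ := exists_nat_one_div_lt (sub_pos.2 h)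
        exact ⟨k, by linarith⟩
      · rintro ⟨k, hk⟩
        have : 0 < 1 / ((k : ℝ) + 1) := by positivity
        linarith
    rw [hU', Monotone.measure_iUnion]
    · refine iSup_le fun k => ?_
      have : 0 < 1 / ((k : ℝ) + 1) := by positivity
      by_contra! hlt
      by_cases hAk : A ≤ x - 1 / ((k : ℝ) + 1)
      · have := csInf_le hbdd (show x - 1 / ((k : ℝ) + 1) ∈ S from ⟨hAk, hlt.le⟩)
        linarith
      · have h0 : ν {z | f z ≤ x - 1 / ((k : ℝ) + 1)} = 0 :=
          measure_mono_null (fun z hz => not_le.2 (lt_of_le_of_lt hz (not_le.1 hAk))) hA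
        rw [h0] at hlt
        exact not_lt_zero hlt
    · intro i j hij z hz
      refine le_trans (show f z ≤ _ from hz) ?_
      have := Nat.one_div_le_one_div (α := ℝ) hij
      linarith
  have hlt : MeasurableSet {z | f z < x} := measurableSet_lt hfm measurable_const
  have heq : MeasurableSet {z | f z = x} := measurableSet_eq_fun hfm measurable_const
  have hgt : MeasurableSet {z | x < f z} := measurableSet_lt measurable_const hfm
  have hdec : ν {z | f z ≤ x} = ν {z | f z < x} + ν {z | f z = x} := by
    rw [← measure_union _ heq]
    · congr 1; ext z; simp [le_iff_lt_or_eq]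
    · exact Set.disjoint_left.2 fun z h1 h2 => (ne_of_lt h1) h2
  obtain ⟨α, hα, hαm⟩ : ∃ α : ENNReal, α ≤ 1 ∧ ν {z | f z < x} + α * ν {z | f z = x} = m := by
    have hb : m - ν {z | f z < x} ≤ ν {z | f z = x} := by
      rw [tsub_le_iff_left, ← hdec]; exact hup
    refine ⟨(m - ν {z | f z < x}) / ν {z | f z = x},
      ENNReal.div_le_of_le_mul (by simpa using hb), ?_⟩
    rw [ENNReal.div_mul_cancel' (fun h => le_antisymm (h ▸ hb) zero_le)
      (fun h => (measure_ne_top _ _ h).elim), add_tsub_cancel_of_le hlow]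
  refine ⟨x, ν.restrict {z | f z < x} + α • ν.restrict {z | f z = x},
    (1 - α) • ν.restrict {z | f z = x} + ν.restrict {z | x < f z}, hAx, csInf_le hbdd hUS,
    ?_, ?_, ?_, ?_⟩
  · have h1 : ν.restrict {z | f z < x} + ν.restrict {z | f z = x} =
        ν.restrict {z | f z ≤ x} := by
      rw [← Measure.restrict_union _ heq]
      · congr 1; ext z; simp [le_iff_lt_or_eq]
      · exact Set.disjoint_left.2 fun z h1 h2 => (ne_of_lt h1) h2
    have h2 : α • ν.restrict {z | f z = x} + (1 - α) • ν.restrict {z | f z = x} =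
        ν.restrict {z | f z = x} := by
      rw [← add_smul, add_tsub_cancel_of_le hα, one_smul]
    have h3 : {z | x < f z} = {z | f z ≤ x}ᶜ := by ext z; simp
    rw [add_assoc, ← add_assoc (α • _), h2, ← add_assoc, h1, h3,
      Measure.restrict_add_restrict_compl (measurableSet_le hfm measurable_const)]
  · simpa using hαm
  · rw [ae_add_measure_iff]
    refine ⟨?_, Measure.ae_smul_measure ?_ _⟩
    · filter_upwards [ae_restrict_mem hlt] with z hz using le_of_lt hz
    · filter_upwards [ae_restrict_mem heq] with z hz using le_of_eq hz
  · rw [ae_add_measure_iff]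
    refine ⟨Measure.ae_smul_measure ?_ _, ?_⟩
    · filter_upwards [ae_restrict_mem heq] with z hz using ge_of_eq hz
    · filter_upwards [ae_restrict_mem hgt] with z hz using le_of_lt hz

lemma measure_univ_eq_of_add {ν₁ ν₂ : Measure ℂ} {a b c : ℕ} (h : (ν₁ + ν₂) Set.univ = c)
    (h₁ : ν₁ Set.univ = a) (hc : c = a + b) : ν₂ Set.univ = b := by
  rw [Measure.add_apply, h₁, hc, Nat.cast_add] at h
  exact (ENNReal.add_right_inj (ENNReal.natCast_ne_top a)).1 h

open Classical in
/-- One step of the recursive construction: the long side of the rectangle is cut either once in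
its middle third, or so that the middle third carries a single unit piece. -/
lemma hasPartition_step {l : ℝ} (hl : 3 ≤ l) {f g : ℂ →L[ℝ] ℝ} (hf : Function.Surjective f)
    {A B C E : ℝ} (hAB : A < B) (hCE : C < E) (hlong : E - C ≤ B - A)
    (hratio : B - A ≤ l * (E - C)) {ν : Measure ℂ} {n : ℕ} (hn : ν Set.univ = n)
    (hνf : ∀ᵐ z ∂ν, f z ∈ Set.Icc A B) (hνg : ∀ᵐ z ∂ν, g z ∈ Set.Icc C E)
    (rec : ∀ (A' B' : ℝ) (ν' : Measure ℂ) (m : ℕ), A ≤ A' → B' ≤ B → B - A ≤ 3 * (B' - A') →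
      3 * (B' - A') ≤ 2 * (B - A) → ν' ≤ ν → ν' Set.univ = m →
      (∀ᵐ z ∂ν', f z ∈ Set.Icc A' B') →
      HasPartition l f g A' B' C E ν' (spreadBound ν' f g)) :
    HasPartition l f g A B C E ν (spreadBound ν f g) := by
  have : IsFiniteMeasure ν := ⟨by rw [hn]; exact ENNReal.natCast_lt_top n⟩
  have hfm : Measurable f := f.continuous.measurable
  obtain ⟨u, hu⟩ : ∃ u, u = A + (B - A) / 3 := ⟨_, rfl⟩
  obtain ⟨v, hv⟩ : ∃ v, v = A + 2 * (B - A) / 3 := ⟨_, rfl⟩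
  by_cases hleft : ∀ᵐ z ∂ν, f z ≤ u
  · refine (rec A u ν n le_rfl (by linarith) (by linarith) (by linarith) le_rfl hn ?_).mono
      le_rfl (by linarith) fun _ _ => le_rfl
    filter_upwards [hνf, hleft] with z h1 h2 using ⟨h1.1, h2⟩
  by_cases hright : ∀ᵐ z ∂ν, v ≤ f z
  · refine (rec v B ν n (by linarith) le_rfl (by linarith) (by linarith) le_rfl hn ?_).mono
      (by linarith) le_rfl fun _ _ => le_rfl
    filter_upwards [hνf, hright] with z h1 h2 using ⟨h2, h1.2⟩
  have hu0 : ν {z | u < f z} ≠ 0 := fun h => hleft (measure_mono_null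
    (fun z hz => not_le.1 (show ¬ f z ≤ u from hz)) h)
  have hv0 : ν {z | f z < v} ≠ 0 := fun h => hright (measure_mono_null
    (fun z hz => not_le.1 (show ¬ v ≤ f z from hz)) h)
  have hun : ν {z | f z ≤ u} < n := by
    have h1 := measure_add_measure_compl (μ := ν) (measurableSet_le hfm (measurable_const (a := u)))
    have h2 : {z | f z ≤ u}ᶜ = {z | u < f z} := by ext z; simp
    rw [← hn, ← h1, h2]
    exact ENNReal.lt_add_right (measure_ne_top _ _) hu0
  obtain ⟨m, r, hmle, hltm, rfl⟩ : ∃ m r : ℕ, m ≤ ν {z | f z ≤ u} ∧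
      ν {z | f z ≤ u} < (m + 1 : ℕ) ∧ n = m + 1 + r := by
    have hex : ∃ k : ℕ, ν {z | f z ≤ u} < k := ⟨n, hun⟩
    obtain ⟨m, hm⟩ : ∃ m, Nat.find hex = m + 1 := by
      refine Nat.exists_eq_succ_of_ne_zero fun h => ?_
      have := Nat.find_spec hex
      rw [h] at this
      simp at this
    obtain ⟨r, hr⟩ := Nat.exists_eq_add_of_le (Nat.find_min' hex hun)
    refine ⟨m, r, not_lt.1 (Nat.find_min hex (by omega)), ?_, by omega⟩
    rw [← hm]; exact Nat.find_spec hex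
  have hBtop : ((m + 1 : ℕ) : ENNReal) ≤ ν {z | f z ≤ B} := by
    have : ν {z | f z ≤ B} = ν Set.univ := measure_congr <| by
      filter_upwards [hνf] with z hz
      exact propext ⟨fun _ => trivial, fun _ => hz.2⟩
    rw [this, hn]
    exact_mod_cast Nat.le_add_right _ _
  obtain ⟨x₂, νL', νR, hAx₂, hx₂B, hsum, hL'm, hL'x, hRx⟩ :=
    exists_split (hνf.mono fun z hz => hz.1) hAB.le hBtop
  have hL'ν : νL' ≤ ν := hsum ▸ Measure.le_add_right le_rfl
  have hRν : νR ≤ ν := hsum ▸ Measure.le_add_left le_rfl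
  have hRm : νR Set.univ = r := measure_univ_eq_of_add (hsum ▸ hn) hL'm rfl
  have hux₂ : u < x₂ := by
    by_contra! hle
    refine not_le.2 hltm ?_
    rw [← hL'm]
    refine le_trans ?_ (hL'ν _)
    refine measure_mono_ae ?_
    filter_upwards [hL'x] with z hz _ using le_trans hz hle
  by_cases hx₂v : x₂ ≤ v
  · have PL := (rec A x₂ νL' (m + 1) le_rfl hx₂B (by linarith) (by linarith) hL'ν hL'm (by
      filter_upwards [ae_mono hL'ν hνf, hL'x] with z h1 h2 using ⟨h1.1, h2⟩)).localize
    have PR := (rec x₂ B νR r hAx₂ le_rfl (by linarith) (by linarith) hRν hRm (by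
      filter_upwards [ae_mono hRν hνf, hRx] with z h1 h2 using ⟨h2, h1.2⟩)).localize
    have P := (PL.mono le_rfl hx₂B fun _ _ => le_rfl).add hf (PR.mono hAx₂ le_rfl fun _ _ => le_rfl)
      hL'x hRx
    rw [hsum] at P
    refine P.mono le_rfl le_rfl fun x y => ?_
    have hLb := spreadBound_mono hL'ν f g x y
    have hRb := spreadBound_mono hRν f g x y
    split_ifs with h1 h2
    · exact absurd (h1.2.trans h2.1) (lt_irrefl _)
    all_goals omega
  push Not at hx₂v
  have : IsFiniteMeasure νL' := ⟨by rw [hL'm]; exact ENNReal.natCast_lt_top _⟩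
  have hmle' : (m : ENNReal) ≤ νL' {z | f z ≤ u} := by
    have h0 : νR {z | f z ≤ u} = 0 := by
      refine measure_mono_null (fun z hz => ?_) hRx
      exact not_le.2 (lt_of_le_of_lt hz hux₂)
    rwa [← hsum, Measure.add_apply, h0, add_zero] at hmle
  obtain ⟨x₁, νL, νM, hAx₁, hx₁u, hsum', hLm, hLx, hMx⟩ :=
    exists_split (ae_mono hL'ν (hνf.mono fun z hz => hz.1)) (by linarith) hmle'
  have hLL' : νL ≤ νL' := hsum' ▸ Measure.le_add_right le_rfl
  have hML' : νM ≤ νL' := hsum' ▸ Measure.le_add_left le_rfl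
  have hLν := hLL'.trans hL'ν
  have hMν := hML'.trans hL'ν
  have hMm : νM Set.univ = 1 := by
    rw [measure_univ_eq_of_add (hsum' ▸ hL'm) hLm rfl, Nat.cast_one]
  have PL : HasPartition l f g A u C E νL
      (fun x y => if m = 0 then 0 else spreadBound νL f g x y) := by
    by_cases hm : m = 0
    · have : νL = 0 := by rw [← Measure.measure_univ_eq_zero, hLm, hm]; simp
      simp only [hm, if_true]
      rw [this]; exact .zero
    · simp only [hm, if_false]
      refine rec A u νL m le_rfl (by linarith) (by linarith) (by linarith) hLν hLm ?_
      filter_upwards [ae_mono hLν hνf, hLx] with z h1 h2 using ⟨h1.1, h2.trans hx₁u⟩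
  have PR : HasPartition l f g v B C E νR
      (fun x y => if r = 0 then 0 else spreadBound νR f g x y) := by
    by_cases hr : r = 0
    · have : νR = 0 := by rw [← Measure.measure_univ_eq_zero, hRm, hr]; simp
      simp only [hr, if_true]
      rw [this]; exact .zero
    · simp only [hr, if_false]
      refine rec v B νR r (by linarith) le_rfl (by linarith) (by linarith) hRν hRm ?_
      filter_upwards [ae_mono hRν hνf, hRx] with z h1 h2 using ⟨hx₂v.le.trans h2, h1.2⟩
  have PM : HasPartition l f g x₁ x₂ C E νM (fun _ _ => 1) := by
    refine .unit (hx₁u.trans_lt hux₂) hCE (by linarith) ?_ ?_ (ae_mono hMν hνg) hMm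
    · have : 3 * (x₂ - x₁) ≤ l * (x₂ - x₁) := mul_le_mul_of_nonneg_right hl (by linarith)
      linarith
    · filter_upwards [hMx, ae_mono hML' hL'x] with z h1 h2 using ⟨h1, h2⟩
  have P := ((PL.localize.mono le_rfl (by linarith) fun _ _ => le_rfl).add hf
    (PM.localize.mono hAx₁ hx₂B fun _ _ => le_rfl) hLx hMx).add hf
    (PR.localize.mono (by linarith) le_rfl fun _ _ => le_rfl) (hsum' ▸ hL'x) hRx
  rw [hsum', hsum] at P
  refine P.mono le_rfl le_rfl fun x y => ?_
  have hone : 1 ≤ spreadBound ν f g x y := by unfold spreadBound; omega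
  have hLb := spreadBound_mono hLν f g x y
  have hRb := spreadBound_mono hRν f g x y
  have hLnull : x₁ < x → νL {z | x ≤ f z} = 0 := fun h =>
    measure_mono_null (fun z hz => not_le.2 (lt_of_lt_of_le h hz)) hLx
  have hRnull : x < x₂ → νR {z | f z ≤ x} = 0 := fun h =>
    measure_mono_null (fun z hz => not_le.2 (lt_of_le_of_lt hz h)) hRx
  have hL1 : m ≠ 0 → x₁ < x → x < u → spreadBound νL f g x y + 1 ≤ spreadBound ν f g x y := by
    intro hm h1 h2
    refine spreadBound_add_one_le hLν y (fun h => h.2 (hLnull h1)) ⟨fun h => hm ?_, fun h => hu0 ?_⟩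
    · have h3 : νL Set.univ = 0 := by
        rw [← nonpos_iff_eq_zero, ← le_antisymm ((hLν _).trans h.le) zero_le]
        refine measure_mono_ae ?_
        filter_upwards [hLx] with z hz _ using le_trans hz h1.le
      exact_mod_cast hLm.symm.trans h3
    · exact measure_mono_null (fun z hz => (h2.trans hz).le) h
  have hR1 : r ≠ 0 → x < x₂ → v < x → spreadBound νR f g x y + 1 ≤ spreadBound ν f g x y := by
    intro hr h1 h2
    refine spreadBound_add_one_le hRν y (fun h => h.1 (hRnull h1)) ⟨fun h => hv0 ?_, fun h => hr ?_⟩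
    · exact measure_mono_null (fun z hz => (lt_trans hz h2).le) h
    · have h3 : νR Set.univ = 0 := by
        rw [← nonpos_iff_eq_zero, ← le_antisymm ((hRν _).trans h.le) zero_le]
        refine measure_mono_ae ?_
        filter_upwards [hRx] with z hz _ using le_trans h1.le hz
      exact_mod_cast hRm.symm.trans h3
  have huv : u < v := by linarith
  split_ifs <;> simp only [Set.mem_Ioo, not_and, not_lt] at * <;>
    first
    | omega
    | (exfalso; linarith)
    | (have := hL1 ‹_› (by linarith) (by linarith); omega)
    | (have := hR1 ‹_› (by linarith) (by linarith); omega)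

/-- If all points have mass less than `1`, so have all small enough balls. -/
lemma exists_ball_measure_lt_one {μ : Measure ℂ} [IsFiniteMeasure μ] {K : Set ℂ}
    (hK : IsCompact K) (hμK : μ Kᶜ = 0) (hpt : ∀ p, μ {p} < 1) :
    ∃ δ > 0, ∀ z, μ (ball z δ) < 1 := by
  have hball : ∀ p, ∃ s > 0, μ (ball p s) < 1 := by
    intro p
    have hI : {p} = ⋂ k : ℕ, ball p (1 / ((k : ℝ) + 1)) := by
      ext z
      simp only [Set.mem_singleton_iff, Set.mem_iInter, mem_ball]
      refine ⟨fun h k => by rw [h, dist_self]; positivity, fun h => ?_⟩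
      refine dist_le_zero.1 (ge_of_tendsto' tendsto_one_div_add_atTop_nhds_zero_nat
        fun k => (h k).le)
    have h1 := hpt p
    rw [hI, Antitone.measure_iInter, iInf_lt_iff] at h1
    · obtain ⟨k, hk⟩ := h1
      exact ⟨_, by positivity, hk⟩
    · exact fun i j hij => ball_subset_ball (Nat.one_div_le_one_div hij)
    · exact fun k => measurableSet_ball.nullMeasurableSet
    · exact ⟨0, measure_ne_top _ _⟩
  choose s hs0 hs using hball
  obtain ⟨δ, hδ, h⟩ := lebesgue_number_lemma_of_metric (c := fun p => ball p (s p)) hK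
    (fun p => isOpen_ball) fun p _ => Set.mem_iUnion.2 ⟨p, mem_ball_self (hs0 p)⟩
  refine ⟨δ / 2, by positivity, fun z => ?_⟩
  by_cases hz : ∃ w ∈ K, w ∈ ball z (δ / 2)
  · obtain ⟨w, hw, hwz⟩ := hz
    obtain ⟨p, hp⟩ := h w hw
    refine (measure_mono (Set.Subset.trans (fun y hy => ?_) hp)).trans_lt (hs p)
    rw [mem_ball] at *
    linarith [dist_triangle_right y w z]
  · rw [measure_mono_null (fun y hy hyK => hz ⟨y, hyK, hy⟩) hμK]
    exact zero_lt_one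

lemma hasPartition_of_area_le {l δ : ℝ} (hl : 3 ≤ l) (hδ : 0 < δ) {μ : Measure ℂ}
    (hμ : ∀ z, μ (ball z δ) < 1) (k : ℕ) : ∀ (A B C E : ℝ) (ν : Measure ℂ) (n : ℕ), A < B → C < E →
    B - A ≤ l * (E - C) → E - C ≤ l * (B - A) →
    (B - A) * (E - C) ≤ (3 / 2) ^ k * (δ ^ 2 / (4 * l)) → ν ≤ μ → ν Set.univ = n →
    (∀ᵐ z ∂ν, z.re ∈ Set.Icc A B) → (∀ᵐ z ∂ν, z.im ∈ Set.Icc C E) →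
    HasPartition l Complex.reCLM Complex.imCLM A B C E ν
      (spreadBound ν Complex.reCLM Complex.imCLM) := by
  have hl0 : 0 < l := by linarith
  induction k with
  | zero =>
    intro A B C E ν n hAB hCE h1 h2 harea hνμ hn hre him
    have hside : ∀ {x y : ℝ}, 0 < x → x ≤ l * y → x * y ≤ δ ^ 2 / (4 * l) → x ≤ δ / 2 := by
      intro x y hx hxy hA
      rw [le_div_iff₀ (by positivity)] at hA
      refine abs_le_of_sq_le_sq' (by nlinarith) (by positivity) |>.2
    rw [pow_zero, one_mul] at harea
    have hB := hside (sub_pos.2 hAB) h1 harea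
    have hE := hside (sub_pos.2 hCE) h2 (by rwa [mul_comm] at harea)
    have hlt : ν Set.univ < 1 := by
      refine lt_of_le_of_lt ?_ (hμ ⟨(A + B) / 2, (C + E) / 2⟩)
      refine le_trans (measure_mono_ae ?_) (hνμ _)
      filter_upwards [hre, him] with z hz1 hz2 _
      rw [Set.mem_Icc] at hz1 hz2
      change z ∈ ball _ _
      rw [mem_ball, Complex.dist_eq]
      refine (Complex.norm_le_abs_re_add_abs_im _).trans_lt ?_
      have h3 : |(z - ⟨(A + B) / 2, (C + E) / 2⟩ : ℂ).re| ≤ δ / 4 := by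
        rw [abs_le, Complex.sub_re]; constructor <;> dsimp only <;> linarith
      have h4 : |(z - ⟨(A + B) / 2, (C + E) / 2⟩ : ℂ).im| ≤ δ / 4 := by
        rw [abs_le, Complex.sub_im]; constructor <;> dsimp only <;> linarith
      linarith
    have hn0 : n = 0 := by
      rw [hn] at hlt
      exact Nat.lt_one_iff.1 (by exact_mod_cast hlt)
    have hν0 : ν = 0 := by rw [← Measure.measure_univ_eq_zero, hn, hn0]; simp
    rw [hν0]
    exact HasPartition.zero.mono le_rfl le_rfl fun _ _ => Nat.zero_le _
  | succ k ih =>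
    intro A B C E ν n hAB hCE h1 h2 harea hνμ hn hre him
    have hstep : ∀ {x y w : ℝ}, 0 < y → x * y ≤ (3 / 2) ^ (k + 1) * (δ ^ 2 / (4 * l)) →
        3 * w ≤ 2 * x → w * y ≤ (3 / 2) ^ k * (δ ^ 2 / (4 * l)) := by
      intro x y w hy hxy hw
      have h3 := mul_le_mul_of_nonneg_right hw hy.le
      rw [pow_succ] at hxy
      linarith
    have hlmul : ∀ {x y : ℝ}, x ≤ 3 * y → 0 < x → x ≤ l * y := fun {x y} h h0 =>
      h.trans (mul_le_mul_of_nonneg_right hl (by linarith))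
    rcases le_total (E - C) (B - A) with hlong | hlong
    · refine hasPartition_step hl Complex.re_surjective hAB hCE hlong h1 hn hre him ?_
      intro A' B' ν' m hA hB hw1 hw2 hν' hm hre'
      refine ih A' B' C E ν' m (by linarith) hCE (by linarith) ?_
        (hstep (sub_pos.2 hCE) harea hw2) (hν'.trans hνμ) hm hre' (ae_mono hν' him)
      exact hlmul (by linarith) (by linarith)
    · have P : HasPartition l Complex.imCLM Complex.reCLM C E A B ν
          (spreadBound ν Complex.imCLM Complex.reCLM) := by
        refine hasPartition_step hl Complex.im_surjective hCE hAB hlong h2 hn him hre ?_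
        intro C' E' ν' m hC hE hw1 hw2 hν' hm him'
        have hw : (B - A) * (E' - C') ≤ (3 / 2) ^ k * (δ ^ 2 / (4 * l)) := by
          rw [mul_comm] at harea ⊢
          exact hstep (sub_pos.2 hAB) harea hw2
        refine (ih A B C' E' ν' m hAB (by linarith) ?_ (by linarith) hw (hν'.trans hνμ) hm
          (ae_mono hν' hre) him').swap.mono le_rfl le_rfl
          fun x y => (spreadBound_swap _ _ _ _ _).le
        exact hlmul (by linarith) (by linarith)
      exact P.swap.mono le_rfl le_rfl fun x y => (spreadBound_swap _ _ _ _ _).le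

lemma rect_eq_reProdIm (a b c e : ℝ) : rect a b c e = Set.Icc a b ×ℂ Set.Icc c e := rfl

lemma interior_rect (a b c e : ℝ) :
    interior (rect a b c e) = Set.Ioo a b ×ℂ Set.Ioo c e := by
  rw [rect_eq_reProdIm, Complex.interior_reProdIm, interior_Icc, interior_Icc]

/-- A partition in the sense of `HasPartition` has as many parts as the total mass. -/
lemma HasPartition.exists_fin {l A B C E : ℝ} (hl : 0 < l) {ν : Measure ℂ} {N : ℝ → ℝ → ℕ}
    (h : HasPartition l Complex.reCLM Complex.imCLM A B C E ν N) {n : ℕ} (hn : ν Set.univ = n) :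
    ∃ (A' B' C' E' : Fin n → ℝ) (μk : Fin n → Measure ℂ),
      (∀ k, A' k < B' k ∧ C' k < E' k ∧ rect (A' k) (B' k) (C' k) (E' k) ⊆ rect A B C E) ∧
      (∀ k, μk k (rect (A' k) (B' k) (C' k) (E' k))ᶜ = 0) ∧
      (∀ k, μk k (rect (A' k) (B' k) (C' k) (E' k)) = 1) ∧
      (∑ k, μk k) = ν ∧
      (∀ k k', k ≠ k' →
        interior (convexHull ℝ (msupport (μk k))) ∩
          interior (convexHull ℝ (msupport (μk k'))) = ∅) ∧
      (∀ k, (B' k - A' k) / (E' k - C' k) ∈ Set.Icc l⁻¹ l) ∧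
      (∀ z : ℂ, {k : Fin n | z ∈ interior (rect (A' k) (B' k) (C' k) (E' k))}.ncard ≤
        N z.re z.im) := by
  classical
  obtain ⟨ι, _, A', B', C', E', μk, h1, h2, h3, h4, h5, h6, h7, h8, h9, h10⟩ := h
  have hcard : Fintype.card ι = n := by
    rw [← h6, Measure.finsetSum_apply] at hn
    simpa [h5] using hn
  obtain ⟨σ⟩ : Nonempty (Fin n ≃ ι) := ⟨(Fintype.equivFinOfCardEq hcard).symm⟩
  have hnull : ∀ k, μk k (rect (A' k) (B' k) (C' k) (E' k))ᶜ = 0 := fun k => by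
    have hr : ∀ᵐ z ∂μk k, z ∈ rect (A' k) (B' k) (C' k) (E' k) := by
      filter_upwards [h3 k, h4 k] with z hz1 hz2 using ⟨hz1, hz2⟩
    exact hr
  refine ⟨A' ∘ σ, B' ∘ σ, C' ∘ σ, E' ∘ σ, μk ∘ σ, fun k => ⟨(h1 _).2.1, (h2 _).2.1, ?_⟩,
    fun k => hnull _, fun k => ?_, ?_, fun k k' hk => h7 _ _ (σ.injective.ne hk), fun k => ?_,
    fun z => ?_⟩
  · exact fun z hz => ⟨Set.Icc_subset_Icc (h1 _).1 (h1 _).2.2 hz.1,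
      Set.Icc_subset_Icc (h2 _).1 (h2 _).2.2 hz.2⟩
  · rw [← h5 (σ k)]
    exact measure_of_measure_compl_eq_zero (hnull _)
  · rw [← h6]
    exact Equiv.sum_comp σ μk
  · have hE : 0 < E' (σ k) - C' (σ k) := sub_pos.2 (h2 _).2.1
    simp only [Function.comp_apply]
    constructor
    · rw [le_div_iff₀ hE, inv_mul_le_iff₀ hl]
      exact h9 _
    · rw [div_le_iff₀ hE]
      exact h8 _
  · refine le_trans (le_of_eq ?_) (h10 z.re z.im)
    rw [← Equiv.sum_comp σ, ← Finset.card_filter, Set.ncard_eq_toFinset_card']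
    congr 1
    ext k
    simp [interior_rect, Complex.mem_reProdIm]

/-- Theorem E (Yulmukhametov/Drasin partition theorem): a measure `μ` of integer mass `n` on a
rectangle `Π` of side ratio `l₀ ≥ 1`, such that on every line parallel to a side of `Π` there
is at most one atom `p` (of mass `< 1`) and `μ(L ∖ {p}) = 0`, can be partitioned as
`μ = Σ μ_k` with `supp μ_k ⊂ Π_k ⊂ Π`, `μ_k(Π_k) = 1`, pairwise disjoint interiors of the
convex hulls of the supports, side ratios of the `Π_k` in `[1/l, l]` with `l = max{l₀, 3}`,
and every point of the plane in the interiors of at most `4` rectangles `Π_k`. -/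
theorem stmt8 (a b c e l₀ : ℝ) (hab : a < b) (hce : c < e)
    (hl₀ : l₀ = max (b - a) (e - c) / min (b - a) (e - c))
    (μ : Measure ℂ) (hsupp : μ (rect a b c e)ᶜ = 0)
    (n : ℕ) (hmass : μ (rect a b c e) = n)
    (hline_v : ∀ x : ℝ, ∃ p : ℂ, p.re = x ∧ μ ({z : ℂ | z.re = x} \ {p}) = 0 ∧ μ {p} < 1)
    (hline_h : ∀ y : ℝ, ∃ p : ℂ, p.im = y ∧ μ ({z : ℂ | z.im = y} \ {p}) = 0 ∧ μ {p} < 1) :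
    ∃ (A B C' E' : Fin n → ℝ) (μk : Fin n → Measure ℂ),
      (∀ k, A k < B k ∧ C' k < E' k ∧
        rect (A k) (B k) (C' k) (E' k) ⊆ rect a b c e) ∧
      (∀ k, μk k (rect (A k) (B k) (C' k) (E' k))ᶜ = 0) ∧
      (∀ k, μk k (rect (A k) (B k) (C' k) (E' k)) = 1) ∧
      (∑ k, μk k) = μ ∧
      (∀ k k', k ≠ k' →
        interior (convexHull ℝ (msupport (μk k))) ∩
          interior (convexHull ℝ (msupport (μk k'))) = ∅) ∧
      (∀ k, (B k - A k) / (E' k - C' k) ∈ Set.Icc (max l₀ 3)⁻¹ (max l₀ 3)) ∧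
      (∀ z : ℂ,
        {k : Fin n | z ∈ interior (rect (A k) (B k) (C' k) (E' k))}.ncard ≤ 4) := by
  have hmass' : μ Set.univ = n := by rw [← hmass, measure_of_measure_compl_eq_zero hsupp]
  have : IsFiniteMeasure μ := ⟨by rw [hmass']; exact ENNReal.natCast_lt_top n⟩
  have hpt : ∀ p, μ {p} < 1 := by
    intro z
    obtain ⟨p, -, h0, h1⟩ := hline_v z.re
    by_cases hzp : z = p
    · rwa [hzp]
    · rw [measure_mono_null (t := {w | w.re = z.re} \ {p})
        (Set.singleton_subset_iff.2 ⟨rfl, hzp⟩) h0]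
      exact zero_lt_one
  have hK : IsCompact (rect a b c e) := isCompact_Icc.reProdIm isCompact_Icc
  obtain ⟨δ, hδ, hball⟩ := exists_ball_measure_lt_one hK hsupp hpt
  set l := max l₀ 3
  have hl3 : 3 ≤ l := le_max_right _ _
  have hmin : 0 < min (b - a) (e - c) := lt_min (sub_pos.2 hab) (sub_pos.2 hce)
  have hmax : max (b - a) (e - c) ≤ l * min (b - a) (e - c) := by
    rw [← div_le_iff₀ hmin, ← hl₀]
    exact le_max_left _ _
  have hratio₁ : b - a ≤ l * (e - c) := (le_max_left _ _).trans
    (hmax.trans (mul_le_mul_of_nonneg_left (min_le_right _ _) (by linarith)))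
  have hratio₂ : e - c ≤ l * (b - a) := (le_max_right _ _).trans
    (hmax.trans (mul_le_mul_of_nonneg_left (min_le_left _ _) (by linarith)))
  obtain ⟨k, hk⟩ := pow_unbounded_of_one_lt ((b - a) * (e - c) / (δ ^ 2 / (4 * l)))
    (show (1 : ℝ) < 3 / 2 by norm_num)
  rw [div_lt_iff₀ (by positivity)] at hk
  have hae : ∀ᵐ z ∂μ, z ∈ rect a b c e := hsupp
  obtain ⟨A, B, C', E', μk, h1, h2, h3, h4, h5, h6, h7⟩ :=
    (hasPartition_of_area_le hl3 hδ hball k a b c e μ n hab hce hratio₁ hratio₂ hk.le le_rfl hmass'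
      (hae.mono fun z hz => hz.1) (hae.mono fun z hz => hz.2)).exists_fin (by linarith) hmass'
  refine ⟨A, B, C', E', μk, h1, h2, h3, h4, h5, h6, fun z => (h7 z).trans ?_⟩
  unfold spreadBound
  split_ifs <;> norm_num
end

section
/- Let ρ : [R₀, ∞) → ℝ be a proximate order with ρ(R) → σ > 0 as R → ∞, set W(R) = R^{ρ(R)} and b(r) = (1 − r)/W(1/(1 − r)). Let Δ > 0. Then W(1/(1 − r)) is eventually strictly increasing in r, so for all sufficiently large n ∈ ℕ there is a unique r_n ∈ (0,1) with Δ·W(1/(1 − r_n)) = 2n, and there exist constants 0 < c₁ ≤ c₂ and n₀ ∈ ℕ such that c₁·b(r_n) ≤ r_{n+1} − r_n ≤ c₂·b(r_n) for all n ≥ n₀; more precisely r_{n+1} − r_n = ((2 + o(1))/(Δσ))·b(r′_n) for some r′_n ∈ (r_n, r_{n+1}) as n → ∞. -/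
open Filter

open Topology

/-- The derivative of `R ↦ R ^ ρ R` in logarithmic form. -/
theorem hasDerivAt_rpow_exponent {ρ : ℝ → ℝ} {ρ' R : ℝ} (hR : 0 < R) (hρ : HasDerivAt ρ ρ' R) :
    HasDerivAt (fun x => x ^ ρ x) ((ρ R + R * ρ' * Real.log R) * R ^ ρ R / R) R := by
  refine ((hasDerivAt_id' R).rpow hρ hR).congr_deriv ?_
  rw [Real.rpow_sub_one hR.ne']
  field_simp

theorem hasDerivAt_one_div_one_sub {r : ℝ} (hr : r < 1) :
    HasDerivAt (fun x : ℝ => 1 / (1 - x)) ((1 / (1 - r)) ^ 2) r := by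
  have h : 1 - r ≠ 0 := by linarith
  simpa [one_div] using ((hasDerivAt_id' r).const_sub 1).fun_inv h

theorem tendsto_one_div_one_sub :
    Tendsto (fun r : ℝ => 1 / (1 - r)) (𝓝[<] 1) atTop := by
  have h : Tendsto (fun r : ℝ => 1 - r) (𝓝[<] 1) (𝓝[>] 0) := by
    refine tendsto_nhdsWithin_iff.2 ⟨?_, ?_⟩
    · have : Tendsto (fun r : ℝ => 1 - r) (𝓝 1) (𝓝 (1 - 1)) := by
        exact tendsto_const_nhds.sub tendsto_id
      rw [sub_self] at this
      exact this.mono_left nhdsWithin_le_nhds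
    · filter_upwards [self_mem_nhdsWithin] with r hr
      simpa using hr
  simpa [one_div, Function.comp_def] using tendsto_inv_nhdsGT_zero.comp h

/-- A function whose exponent has a positive limit tends to infinity. -/
theorem tendsto_rpow_exponent_atTop {ρ : ℝ → ℝ} {σ : ℝ} (hσ : 0 < σ)
    (hρ : Tendsto ρ atTop (𝓝 σ)) : Tendsto (fun R => R ^ ρ R) atTop atTop := by
  refine tendsto_atTop_mono' _ ?_ (tendsto_rpow_atTop (half_pos hσ))
  filter_upwards [eventually_ge_atTop 1, hρ.eventually_const_le (half_lt_self hσ)] with R hR h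
  exact Real.rpow_le_rpow_of_exponent_le hR h

/-- If `F' = g F / (1 - r)` near `1` with `g → σ > 0` and `F → ∞`, then `F` is eventually strictly
increasing, and the gaps between the solutions of `Δ F = 2 n` are comparable to `(1 - r) / F`. -/
theorem exists_level_radii {F g : ℝ → ℝ} {σ Δ : ℝ} (hσ : 0 < σ) (hΔ : 0 < Δ)
    (hF : Tendsto F (𝓝[<] 1) atTop) (hg : Tendsto g (𝓝[<] 1) (𝓝 σ))
    (hderiv : ∀ᶠ r in 𝓝[<] 1, HasDerivAt F (g r * F r / (1 - r)) r) :
    ∃ r' ∈ Set.Ioo (0 : ℝ) 1, StrictMonoOn F (Set.Ioo r' 1) ∧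
      ∃ (n₁ : ℕ) (rs : ℕ → ℝ),
        (∀ n : ℕ, n₁ ≤ n → rs n ∈ Set.Ioo r' 1 ∧ Δ * F (rs n) = 2 * n ∧
          ∀ r ∈ Set.Ioo r' (1 : ℝ), Δ * F r = 2 * n → r = rs n) ∧
        (∃ c₁ c₂ : ℝ, 0 < c₁ ∧ c₁ ≤ c₂ ∧ ∃ n₀ : ℕ, ∀ n : ℕ, n₀ ≤ n →
          c₁ * ((1 - rs n) / F (rs n)) ≤ rs (n + 1) - rs n ∧
          rs (n + 1) - rs n ≤ c₂ * ((1 - rs n) / F (rs n))) ∧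
        (∃ rr : ℕ → ℝ,
          (∀ᶠ n : ℕ in atTop, rr n ∈ Set.Ioo (rs n) (rs (n + 1))) ∧
          Tendsto (fun n : ℕ => (rs (n + 1) - rs n) / ((1 - rr n) / F (rr n)))
            atTop (𝓝 (2 / (Δ * σ)))) := by
  obtain ⟨a, ha, hasub⟩ := (mem_nhdsLT_iff_exists_Ioo_subset (a := (1 : ℝ))).1
    (hderiv.and ((hF.eventually_gt_atTop 0).and (hg.eventually_const_lt hσ)))
  obtain ⟨r', hr'0, hr'1, har⟩ : ∃ r' : ℝ, 0 < r' ∧ r' < 1 ∧ a ≤ r' :=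
    ⟨max a (1 / 2), by positivity, max_lt ha (by norm_num), le_max_left _ _⟩
  have hd : ∀ r ∈ Set.Ioo r' 1, HasDerivAt F (g r * F r / (1 - r)) r := fun r hr =>
    (hasub ⟨har.trans_lt hr.1, hr.2⟩).1
  have hpos : ∀ r ∈ Set.Ioo r' 1, 0 < F r := fun r hr =>
    (hasub ⟨har.trans_lt hr.1, hr.2⟩).2.1
  have hgpos : ∀ r ∈ Set.Ioo r' 1, 0 < g r := fun r hr =>
    (hasub ⟨har.trans_lt hr.1, hr.2⟩).2.2
  have hcont : ContinuousOn F (Set.Ioo r' 1) := fun r hr =>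
    (hd r hr).continuousAt.continuousWithinAt
  have hmono : StrictMonoOn F (Set.Ioo r' 1) := by
    refine strictMonoOn_of_deriv_pos (convex_Ioo _ _) hcont fun r hr => ?_
    rw [interior_Ioo] at hr
    rw [(hd r hr).deriv]
    exact div_pos (mul_pos (hgpos r hr) (hpos r hr)) (sub_pos.2 hr.2)
  have hlt : ∀ {x y}, x ∈ Set.Ioo r' 1 → y ∈ Set.Ioo r' 1 → F x < F y → x < y :=
    fun hx hy h => (hmono.lt_iff_lt hx hy).1 h
  obtain ⟨m, hm⟩ := exists_between hr'1
  have hexists : ∀ y, F m ≤ y → ∃ r ∈ Set.Ioo r' 1, F r = y := by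
    intro y hy
    obtain ⟨s, hs, hms⟩ := ((hF.eventually_ge_atTop y).and
      (Ioo_mem_nhdsLT hm.2)).exists
    obtain ⟨r, hr, hry⟩ := intermediate_value_Icc hms.1.le
      (hcont.mono fun x hx => ⟨hm.1.trans_le hx.1, hx.2.trans_lt hms.2⟩) ⟨hy, hs⟩
    exact ⟨r, ⟨hm.1.trans_le hr.1, hr.2.trans_lt hms.2⟩, hry⟩
  have hlevel : Tendsto (fun n : ℕ => 2 * (n : ℝ) / Δ) atTop atTop :=
    (tendsto_natCast_atTop_atTop.const_mul_atTop two_pos).atTop_div_const hΔ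
  obtain ⟨n₁, hn₁⟩ := eventually_atTop.1 (hlevel.eventually_ge_atTop (F m))
  have hchoice : ∀ n : ℕ, ∃ r, n₁ ≤ n → r ∈ Set.Ioo r' 1 ∧ F r = 2 * n / Δ := fun n => by
    by_cases h : n₁ ≤ n
    · obtain ⟨r, hr⟩ := hexists _ (hn₁ n h)
      exact ⟨r, fun _ => hr⟩
    · exact ⟨0, fun h' => absurd h' h⟩
  choose rs hrs using hchoice
  have hrs_lt : ∀ n, n₁ ≤ n → rs n < rs (n + 1) := fun n hn => by
    refine hlt (hrs n hn).1 (hrs (n + 1) (by omega)).1 ?_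
    rw [(hrs n hn).2, (hrs (n + 1) (by omega)).2]
    push_cast
    gcongr
    linarith
  have hmvt : ∀ n, ∃ c, n₁ ≤ n → c ∈ Set.Ioo (rs n) (rs (n + 1)) ∧
      g c * F c / (1 - c) * (rs (n + 1) - rs n) = 2 / Δ := fun n => by
    by_cases h : n₁ ≤ n
    · have h1 := hrs n h
      have h2 := hrs (n + 1) (by omega)
      have hsub : Set.Icc (rs n) (rs (n + 1)) ⊆ Set.Ioo r' 1 := fun x hx =>
        ⟨h1.1.1.trans_le hx.1, hx.2.trans_lt h2.1.2⟩
      obtain ⟨c, hc, hceq⟩ := exists_hasDerivAt_eq_slope F _ (hrs_lt n h) (hcont.mono hsub)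
        fun x hx => hd x (hsub (Set.Ioo_subset_Icc_self hx))
      refine ⟨c, fun _ => ⟨hc, ?_⟩⟩
      rw [hceq, div_mul_cancel₀ _ (sub_pos.2 (hrs_lt n h)).ne', h1.2, h2.2]
      push_cast
      ring
    · exact ⟨0, fun h' => absurd h' h⟩
  choose rr hrr using hmvt
  have hrrmem : ∀ n, n₁ ≤ n → rr n ∈ Set.Ioo r' 1 := fun n hn =>
    ⟨(hrs n hn).1.1.trans (hrr n hn).1.1, (hrr n hn).1.2.trans (hrs (n + 1) (by omega)).1.2⟩
  have hrr1 : Tendsto rr atTop (𝓝[<] 1) := by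
    refine (nhdsLT_basis (1 : ℝ)).tendsto_right_iff.2 fun s hs => ?_
    obtain ⟨t, ht⟩ := exists_between (max_lt hs hr'1)
    have htm : t ∈ Set.Ioo r' 1 := ⟨(le_max_right _ _).trans_lt ht.1, ht.2⟩
    filter_upwards [hlevel.eventually_gt_atTop (F t), eventually_ge_atTop n₁] with n hn hn1
    rw [← (hrs n hn1).2] at hn
    exact ⟨((le_max_left _ _).trans_lt ht.1).trans
      ((hlt htm (hrs n hn1).1 hn).trans (hrr n hn1).1.1), (hrrmem n hn1).2⟩
  have hquot : Tendsto (fun n : ℕ => (rs (n + 1) - rs n) / ((1 - rr n) / F (rr n)))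
      atTop (𝓝 (2 / (Δ * σ))) := by
    have h : Tendsto (fun n => 2 / (Δ * g (rr n))) atTop (𝓝 (2 / (Δ * σ))) :=
      tendsto_const_nhds.div ((hg.comp hrr1).const_mul Δ) (by positivity)
    refine h.congr' ?_
    filter_upwards [eventually_ge_atTop n₁] with n hn
    have h1 := hpos _ (hrrmem n hn)
    have h2 := hgpos _ (hrrmem n hn)
    have h3 := sub_pos.2 (hrrmem n hn).2
    have h4 := (hrr n hn).2
    field_simp at h4 ⊢
    linarith
  refine ⟨r', ⟨hr'0, hr'1⟩, hmono, n₁, rs, fun n hn => ⟨(hrs n hn).1, ?_, fun r hr h => ?_⟩, ?_,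
    rr, (eventually_ge_atTop n₁).mono fun n hn => (hrr n hn).1, hquot⟩
  · rw [(hrs n hn).2]
    field_simp
  · refine hmono.injOn hr (hrs n hn).1 ?_
    rw [(hrs n hn).2, ← h]
    field_simp
  · obtain ⟨κ, hκ, hκdef⟩ : ∃ κ, 0 < κ ∧ κ = 2 / (Δ * σ) := ⟨_, by positivity, rfl⟩
    rw [← hκdef] at hquot
    refine ⟨κ / 8, 2 * κ, by positivity, by linarith, eventually_atTop.1 ?_⟩
    filter_upwards [eventually_ge_atTop n₁, eventually_ge_atTop 1,
      hquot.eventually_const_lt (half_lt_self hκ),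
      hquot.eventually_lt_const (show κ < 2 * κ by linarith),
      hlevel.eventually_ge_atTop (4 * κ)] with n hn hn1 hlo hhi hbig
    have hx := (hrs n hn).1
    have hc := hrrmem n hn
    have hy := (hrs (n + 1) (by omega)).1
    have hFx := hpos _ hx
    have hFc := hpos _ hc
    have hxc := (hrr n hn).1.1
    have hcy := (hrr n hn).1.2
    have hFxc := hmono hx hc hxc
    have hFcy := hmono hc hy hcy
    have hFy : F (rs (n + 1)) ≤ 2 * F (rs n) := by
      rw [(hrs n hn).2, (hrs (n + 1) (by omega)).2, ← mul_div_assoc]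
      have : (1 : ℝ) ≤ n := by exact_mod_cast hn1
      push_cast
      gcongr
      linarith
    rw [← (hrs n hn).2] at hbig
    have h1x := sub_pos.2 hx.2
    have h1c := sub_pos.2 hc.2
    rw [lt_div_iff₀ (by positivity)] at hlo
    rw [div_lt_iff₀ (by positivity)] at hhi
    have hupper : rs (n + 1) - rs n ≤ 2 * κ * ((1 - rs n) / F (rs n)) :=
      hhi.le.trans (by gcongr)
    have hhalf : 2 * κ * ((1 - rs n) / F (rs n)) ≤ (1 - rs n) / 2 := by
      rw [← mul_div_assoc, div_le_iff₀ hFx]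
      nlinarith
    have hlower : (1 - rs n) / 2 / (2 * F (rs n)) ≤ (1 - rr n) / F (rr n) :=
      div_le_div₀ h1c.le (by linarith) hFc (by linarith)
    refine ⟨?_, hupper⟩
    calc κ / 8 * ((1 - rs n) / F (rs n))
        = κ / 2 * ((1 - rs n) / 2 / (2 * F (rs n))) := by field_simp; norm_num
      _ ≤ κ / 2 * ((1 - rr n) / F (rr n)) := by gcongr
      _ ≤ rs (n + 1) - rs n := hlo.le

/-- Construction of the radii `r_n` in the proof of Theorem 2 of the paper: for a proximate
order `ρ` with `ρ(R) → σ > 0`, `W(R) = R^{ρ(R)}`, `b(r) = (1 − r)/W(1/(1 − r))` and `Δ > 0`,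
the function `r ↦ W(1/(1 − r))` is eventually strictly increasing, for all large `n` there is
a unique `r_n` with `Δ·W(1/(1 − r_n)) = 2n`, and `r_{n+1} − r_n ≍ b(r_n)`; more precisely
`r_{n+1} − r_n = ((2 + o(1))/(Δσ))·b(r′_n)` for some `r′_n ∈ (r_n, r_{n+1})`. -/
theorem stmt19 (ρf : ℝ → ℝ) (R₀ σ : ℝ) (hR₀ : 0 < R₀) (hσ : 0 < σ)
    (hdiff : DifferentiableOn ℝ ρf (Set.Ici R₀))
    (hlim : Tendsto ρf atTop (nhds σ))
    (hslope : Tendsto (fun R : ℝ => R * deriv ρf R * Real.log R) atTop (nhds 0))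
    (Δ : ℝ) (hΔ : 0 < Δ) :
    ∃ r' ∈ Set.Ioo (0:ℝ) 1,
      StrictMonoOn (fun r : ℝ => Real.rpow (1 / (1 - r)) (ρf (1 / (1 - r))))
        (Set.Ioo r' 1) ∧
      ∃ (n₁ : ℕ) (rs : ℕ → ℝ),
        (∀ n : ℕ, n₁ ≤ n →
          rs n ∈ Set.Ioo r' 1 ∧
          Δ * Real.rpow (1 / (1 - rs n)) (ρf (1 / (1 - rs n))) = 2 * n ∧
          ∀ r ∈ Set.Ioo r' (1:ℝ),
            Δ * Real.rpow (1 / (1 - r)) (ρf (1 / (1 - r))) = 2 * n → r = rs n) ∧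
        (∃ c₁ c₂ : ℝ, 0 < c₁ ∧ c₁ ≤ c₂ ∧ ∃ n₀ : ℕ, ∀ n : ℕ, n₀ ≤ n →
          c₁ * ((1 - rs n) / Real.rpow (1 / (1 - rs n)) (ρf (1 / (1 - rs n))))
              ≤ rs (n+1) - rs n ∧
          rs (n+1) - rs n
              ≤ c₂ * ((1 - rs n) / Real.rpow (1 / (1 - rs n)) (ρf (1 / (1 - rs n))))) ∧
        (∃ rr : ℕ → ℝ,
          (∀ᶠ n : ℕ in atTop, rr n ∈ Set.Ioo (rs n) (rs (n+1))) ∧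
          Tendsto (fun n : ℕ => (rs (n+1) - rs n) /
              ((1 - rr n) / Real.rpow (1 / (1 - rr n)) (ρf (1 / (1 - rr n)))))
            atTop (nhds (2 / (Δ * σ)))) := by
  refine exists_level_radii
    (F := fun r => Real.rpow (1 / (1 - r)) (ρf (1 / (1 - r))))
    (g := fun r => ρf (1 / (1 - r)) +
      1 / (1 - r) * deriv ρf (1 / (1 - r)) * Real.log (1 / (1 - r))) hσ hΔ
    ((tendsto_rpow_exponent_atTop hσ hlim).comp tendsto_one_div_one_sub) ?_ ?_
  · have h := (hlim.add hslope).comp tendsto_one_div_one_sub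
    rwa [add_zero] at h
  · filter_upwards [tendsto_one_div_one_sub.eventually_gt_atTop R₀, self_mem_nhdsWithin]
      with r hr hr1
    have hρ := (hdiff.differentiableAt (Ici_mem_nhds hr)).hasDerivAt
    have h1 : 1 - r ≠ 0 := (sub_pos.2 hr1).ne'
    refine ((hasDerivAt_rpow_exponent (hR₀.trans hr) hρ).comp r
      (hasDerivAt_one_div_one_sub hr1)).congr_deriv ?_
    simp only [Real.rpow_eq_pow]
    field_simp
end
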